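/- Fix n ≥ 1. For a string c ∈ {I,H,N}^n define f_c : {0,1}^n → {0,1,i,-1,-i} ⊂ ℂ as follows: let P = {j : c_j ≠ I} with increasing enumeration p_0 < p_1 < … < p_{m-1}; for j with c_j = I let q(j) be the least element of P greater than j if one exists and q(j) = n otherwise, with the convention x_n = 0; set f_c(x) = (∏_{j : c_j = I} [x_j = x_{q(j)}]) · i^{2·∑_{i=0}^{m-2} x_{p_i}·x_{p_{i+1}} + ∑_{j : c_j = N} x_j}, where [·] equals 1 if the condition holds and 0 otherwise and i = √−1. Let ℬ = { f_c ∘ σ : c ∈ {I,H,N}^n, σ a permutation of the n coordinates }. Then the cardinality of ℬ satisfies |ℬ| = 3·∑_{k=0}^{n} 2^{k-2}·k!·S(n,k) + 2^n − 1/2 (an identity of rational numbers; equivalently 4·|ℬ| = 3·∑_{k=0}^{n} 2^{k}·k!·S(n,k) + 2^{n+2} − 2). -/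

import Mathlib

/-- Stirling numbers of the second kind. -/
def stirling2 : ℕ → ℕ → ℕ
  | 0, 0 => 1
  | 0, _ + 1 => 0
  | _ + 1, 0 => 0
  | n + 1, k + 1 => (k + 1) * stirling2 n (k + 1) + stirling2 n k

/-- The `0/1` value of the bit `x_j`, with the convention `x_n = 0`. -/
def extBit (n : ℕ) (x : Fin n → Bool) (j : ℕ) : ℕ :=
  if h : j < n then (x ⟨j, h⟩).toNat else 0

/-- The least element of `P` strictly greater than `j`, or `n` if none exists. -/
def nxt (n : ℕ) (P : Finset ℕ) (j : ℕ) : ℕ :=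
  if h : (P.filter fun p => j < p).Nonempty then (P.filter fun p => j < p).min' h else n

/-- The positions of the string `c ∈ {I,H,N}^n` carrying an `H` or an `N`
(`c j = 0` means `I`, `c j = 1` means `H`, `c j = 2` means `N`). -/
def PsetIHN (n : ℕ) (c : Fin n → Fin 3) : Finset ℕ :=
  (Finset.univ.filter fun j => c j ≠ 0).image Fin.val

/-- The complementary array `f_c : {0,1}^n → {0,1,i,-1,-i} ⊂ ℂ` of the paper's
construction seeded by `c ∈ {I,H,N}^n`:
`f_c(x) = (∏_{j : c_j = I} [x_j = x_{q(j)}]) ·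
  i^{2 ∑_i x_{p_i} x_{p_{i+1}} + ∑_{j : c_j = N} x_j}`,
where `p_0 < … < p_{m-1}` enumerates `P = {j : c_j ≠ I}`, `q(j)` is the least
element of `P` greater than `j` (or `n`), and `x_n = 0`.  (The quadratic sum
over consecutive pairs of `P` is expressed as `∑_{j ∈ P} x_j x_{q(j)}`.) -/
def fIHN (n : ℕ) (c : Fin n → Fin 3) (x : Fin n → Bool) : ℂ :=
  (∏ j ∈ Finset.univ.filter fun j : Fin n => c j = 0,
      if (x j).toNat = extBit n x (nxt n (PsetIHN n c) j.val) then 1 else 0) *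
    Complex.I ^ (2 * ∑ j ∈ PsetIHN n c, extBit n x j * extBit n x (nxt n (PsetIHN n c) j)
        + ∑ j ∈ Finset.univ.filter fun j : Fin n => c j = 2, (x j).toNat)

/-! ### Counting functions with a prescribed image -/

theorem card_filter_image_eq {β : Type*} [Fintype β] [DecidableEq β] (n : ℕ) (s : Finset β) :
    (Finset.univ.filter fun g : Fin n → β => Finset.univ.image g = s).card =
      s.card.factorial * stirling2 n s.card := by
  induction n generalizing s with
  | zero =>
    rcases s.eq_empty_or_nonempty with rfl | hs
    · simp [stirling2]
    · obtain ⟨k, hk⟩ := Nat.exists_eq_succ_of_ne_zero hs.card_pos.ne'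
      rw [hk]
      simp [stirling2, hs.ne_empty.symm]
  | succ n ih =>
    have key : ∀ (a : β) (t : Finset β),
        insert a t = s ↔ a ∈ s ∧ (t = s ∨ t = s.erase a) := by
      intro a t
      constructor
      · rintro rfl
        refine ⟨Finset.mem_insert_self a t, ?_⟩
        by_cases h : a ∈ t
        · exact Or.inl (Finset.insert_eq_of_mem h).symm
        · exact Or.inr (Finset.erase_insert h).symm
      · rintro ⟨ha, rfl | rfl⟩
        · exact Finset.insert_eq_of_mem ha
        · exact Finset.insert_erase ha
    have himg : ∀ (a : β) (g : Fin n → β),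
        Finset.univ.image (Fin.cons a g : Fin (n + 1) → β) = insert a (Finset.univ.image g) := by
      intro a g
      ext b
      simp [Fin.exists_fin_succ, eq_comm]
    have hfib : ∀ a ∈ s, (Finset.univ.filter fun g : Fin n → β =>
        insert a (Finset.univ.image g) = s).card =
          s.card.factorial * stirling2 n s.card +
            (s.card - 1).factorial * stirling2 n (s.card - 1) := by
      intro a ha
      rw [← ih s, ← Finset.card_erase_of_mem ha, ← ih (s.erase a),
        ← Finset.card_union_of_disjoint, ← Finset.filter_or]
      · simp [key, ha]
      · refine Finset.disjoint_filter.2 fun g _ h1 h2 => ?_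
        exact Finset.notMem_erase a s (h2 ▸ h1 ▸ ha)
    have hsum : (Finset.univ.filter fun g : Fin (n + 1) → β => Finset.univ.image g = s).card =
        ∑ a ∈ s, (Finset.univ.filter fun g : Fin n → β =>
          insert a (Finset.univ.image g) = s).card := by
      rw [← Finset.card_sigma]
      symm
      refine Finset.card_bij (fun p _ => (Fin.cons p.1 p.2 : Fin (n + 1) → β)) ?_ ?_ ?_
      · rintro ⟨a, g⟩ h
        simp only [Finset.mem_sigma, Finset.mem_filter, Finset.mem_univ, true_and] at h ⊢
        rw [himg, h.2]
      · rintro ⟨a, g⟩ _ ⟨b, g'⟩ _ h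
        obtain ⟨rfl, rfl⟩ := Fin.cons_injective2 h
        rfl
      · intro g h
        simp only [Finset.mem_filter, Finset.mem_univ, true_and] at h
        have h' : insert (g 0) (Finset.univ.image (Fin.tail g)) = s := by
          rw [← himg, Fin.cons_self_tail, h]
        refine ⟨⟨g 0, Fin.tail g⟩, ?_, Fin.cons_self_tail g⟩
        simp only [Finset.mem_sigma, Finset.mem_filter, Finset.mem_univ, true_and]
        exact ⟨h' ▸ Finset.mem_insert_self _ _, h'⟩
    rw [hsum, Finset.sum_congr rfl hfib, Finset.sum_const, smul_eq_mul]
    rcases s.card with _ | k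
    · simp [stirling2]
    · simp only [stirling2, Nat.add_sub_cancel, Nat.factorial_succ]
      ring

theorem stirling2_eq_zero_of_lt {n k : ℕ} (h : n < k) : stirling2 n k = 0 := by
  induction n generalizing k with
  | zero => obtain ⟨k, rfl⟩ := Nat.exists_eq_succ_of_ne_zero h.ne'; rfl
  | succ n ih =>
    obtain ⟨k, rfl⟩ := Nat.exists_eq_succ_of_ne_zero (Nat.ne_zero_of_lt h)
    simp [stirling2, ih (show n < k by omega), ih (show n < k + 1 by omega)]

theorem stirling2_succ_one (n : ℕ) : stirling2 (n + 1) 1 = 1 := by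
  induction n with
  | zero => rfl
  | succ n ih => rw [stirling2, ih]; rfl

theorem stirling2_succ_two (n : ℕ) : stirling2 (n + 1) 2 + 1 = 2 ^ n := by
  induction n with
  | zero => rfl
  | succ n ih =>
    have := stirling2_succ_one n
    rw [stirling2, this, pow_succ, ← ih]
    ring

/-- The ordered partitions of `Fin n` into `m` nonempty blocks together with a possibly empty
zero block, the fibre over `none`. -/
abbrev BlockMap (n m : ℕ) : Type :=
  {g : Fin n → Option (Fin m) // ∀ k, ∃ j, g j = some k}

theorem card_blockMap (n m : ℕ) :
    Fintype.card (BlockMap n m) =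
      m.factorial * stirling2 n m + (m + 1).factorial * stirling2 n (m + 1) := by
  have h1 := card_filter_image_eq n ((Finset.univ : Finset (Option (Fin m))).erase none)
  have h2 := card_filter_image_eq n (Finset.univ : Finset (Option (Fin m)))
  rw [Finset.card_erase_of_mem (Finset.mem_univ _)] at h1
  simp only [Finset.card_univ, Fintype.card_option, Fintype.card_fin,
    Nat.add_sub_cancel] at h1 h2
  rw [← h1, ← h2, ← Finset.card_union_of_disjoint, ← Finset.filter_or, Fintype.card_subtype]
  · congr 1
    ext g
    simp only [Finset.mem_filter, Finset.mem_univ, true_and]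
    constructor
    · intro h
      by_cases hn : none ∈ Finset.univ.image g
      · right
        ext o
        cases o with
        | none => simpa using hn
        | some k => simpa using h k
      · left
        ext o
        cases o with
        | none => simpa using hn
        | some k => simpa using h k
    · rintro (h | h) k
      · have : some k ∈ Finset.univ.image g := by rw [h]; simp
        simpa using this
      · have : some k ∈ Finset.univ.image g := by rw [h]; simp
        simpa using this
  · refine Finset.disjoint_filter.2 fun g _ h1 h2 => ?_
    exact Finset.notMem_erase none Finset.univ (h1 ▸ h2 ▸ Finset.mem_univ none)

theorem card_blockMap_zero {n : ℕ} (hn : 1 ≤ n) : Fintype.card (BlockMap n 0) = 1 := by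
  obtain ⟨n, rfl⟩ := Nat.exists_eq_succ_of_ne_zero (Nat.one_le_iff_ne_zero.1 hn)
  rw [card_blockMap, zero_add, Nat.succ_eq_add_one, stirling2_succ_one]
  simp [stirling2]

theorem card_blockMap_one {n : ℕ} (hn : 1 ≤ n) : Fintype.card (BlockMap n 1) + 1 = 2 ^ n := by
  obtain ⟨n, rfl⟩ := Nat.exists_eq_succ_of_ne_zero (Nat.one_le_iff_ne_zero.1 hn)
  rw [card_blockMap, Nat.succ_eq_add_one, stirling2_succ_one, pow_succ, ← stirling2_succ_two]
  simp
  ring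

/-! ### Functions whose fibres are the orbits of an involution -/

theorem two_mul_ncard_range {D X : Type*} [Fintype D] [DecidableEq D] (F : D → X) (r : D → D)
    (hF : ∀ d d', F d = F d' ↔ d' = d ∨ d' = r d) :
    2 * (Set.range F).ncard =
      Fintype.card D + (Finset.univ.filter fun d => r d = d).card := by
  classical
  have hr : ∀ d, r (r d) = d := by
    intro d
    rcases (hF (r d) d).1 ((hF d (r d)).2 (Or.inr rfl)).symm with h | h
    · rw [← h, ← h]
    · exact h.symm
  have hrange : Set.range F = ↑(Finset.univ.image F) := by simp
  rw [hrange, Set.ncard_coe_finset, ← Finset.card_univ,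
    Finset.card_eq_sum_card_image F Finset.univ,
    Finset.card_eq_sum_card_fiberwise (f := F) (t := Finset.univ.image F)
      (fun d _ => by simp), ← Finset.sum_add_distrib, mul_comm, ← smul_eq_mul,
    ← Finset.sum_const]
  refine Finset.sum_congr rfl fun b hb => ?_
  obtain ⟨d, -, rfl⟩ := Finset.mem_image.1 hb
  have h1 : (Finset.univ.filter fun d' => F d' = F d) = {d, r d} := by
    ext d'
    rw [Finset.mem_filter, eq_comm (a := F d'), hF]
    simp
  rw [h1, Finset.filter_filter]
  by_cases h : r d = d
  · have h2 : (Finset.univ.filter fun d' => r d' = d' ∧ F d' = F d) = {d} := by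
      ext d'
      rw [Finset.mem_filter, eq_comm (a := F d'), hF, h]
      simp only [Finset.mem_univ, true_and, or_self, Finset.mem_singleton]
      exact ⟨fun h => h.2, fun e => ⟨by rw [e, h], e⟩⟩
    rw [h2, h]
    simp
  · have h2 : (Finset.univ.filter fun d' => r d' = d' ∧ F d' = F d) = ∅ := by
      refine Finset.filter_eq_empty_iff.2 fun d' _ h' => ?_
      obtain ⟨e, h'⟩ := h'
      rcases (hF d d').1 h'.symm with rfl | rfl
      · exact h e
      · exact h (by rw [hr] at e; exact e.symm)
    rw [h2, Finset.card_pair (Ne.symm h)]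
    simp

/-! ### Automorphisms of a path -/

theorem eq_id_or_eq_rev_of_adj {m : ℕ} (π : Fin m ≃ Fin m)
    (h : ∀ a b : Fin m, (a.val + 1 = b.val ∨ b.val + 1 = a.val) ↔
      ((π a).val + 1 = (π b).val ∨ (π b).val + 1 = (π a).val)) :
    (∀ a, π a = a) ∨ ∀ a, π a = a.rev := by
  have fixed : ∀ ρ : Fin m ≃ Fin m,
      (∀ a b : Fin m, (a.val + 1 = b.val ∨ b.val + 1 = a.val) →
        ((ρ a).val + 1 = (ρ b).val ∨ (ρ b).val + 1 = (ρ a).val)) →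
      (∀ hm : 0 < m, (ρ ⟨0, hm⟩).val = 0) → ∀ k (hk : k < m), (ρ ⟨k, hk⟩).val = k := by
    intro ρ hρ h0 k
    induction k using Nat.strong_induction_on with
    | _ k ih =>
      intro hk
      rcases k with _ | k
      · exact h0 hk
      have h1 := ih k (by omega) (by omega)
      have h2 := hρ ⟨k, by omega⟩ ⟨k + 1, hk⟩ (Or.inl rfl)
      rw [h1] at h2
      rcases h2 with h2 | h2
      · exact h2.symm
      · have h3 := ih (k - 1) (by omega) (by omega)
        have h4 : ρ ⟨k + 1, hk⟩ = ρ ⟨k - 1, by omega⟩ := Fin.ext (by omega)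
        have := congrArg Fin.val (ρ.injective h4)
        simp only at this
        omega
  rcases Nat.eq_zero_or_pos m with rfl | hm
  · exact Or.inl fun a => a.elim0
  have hend : (π ⟨0, hm⟩).val = 0 ∨ (π ⟨0, hm⟩).val + 1 = m := by
    by_contra! hc
    have hlt := (π ⟨0, hm⟩).isLt
    have e1 := (h ⟨0, hm⟩ (π.symm ⟨(π ⟨0, hm⟩).val + 1, by omega⟩)).2 (by simp)
    have e2 := (h ⟨0, hm⟩ (π.symm ⟨(π ⟨0, hm⟩).val - 1, by omega⟩)).2
      (by simp only [Equiv.apply_symm_apply]; omega)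
    have e3 : π.symm ⟨(π ⟨0, hm⟩).val + 1, by omega⟩ =
        π.symm ⟨(π ⟨0, hm⟩).val - 1, by omega⟩ := Fin.ext (by simp only at e1 e2; omega)
    have := congrArg Fin.val (π.symm.injective e3)
    simp only at this
    omega
  rcases hend with h0 | h0
  · exact Or.inl fun a => Fin.ext (fixed π (fun a b => (h a b).1) (fun _ => h0) a.val a.isLt)
  · right
    intro a
    have h1 := fixed (π.trans Fin.revPerm) (fun a b hab => by
      have := (h a b).1 hab
      simp only [Equiv.trans_apply, Fin.revPerm_apply, Fin.val_rev]
      omega) (fun _ => by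
      simp only [Equiv.trans_apply, Fin.revPerm_apply, Fin.val_rev]
      omega) a.val a.isLt
    simp only [Equiv.trans_apply, Fin.revPerm_apply, Fin.eta] at h1
    rw [← Fin.rev_rev (π a)]
    exact congrArg Fin.rev (Fin.ext h1)

/-! ### Phase functions of labelled paths of blocks -/

/-- The exponent of `i` attached to a path on `m` vertices with labels `ℓ`. -/
def pathExponent {m : ℕ} (ℓ : Fin m → Bool) (y : Fin m → Bool) : ℕ :=
  (∑ a, ∑ b, if a.val + 1 = b.val then 2 * ((y a).toNat * (y b).toNat) else 0) +
    ∑ a, if ℓ a then (y a).toNat else 0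

/-- Block values spread to the coordinates, with value `false` on the zero block. -/
def spread {n m : ℕ} (g : Fin n → Option (Fin m)) (y : Fin m → Bool) (j : Fin n) : Bool :=
  (g j).elim false y

open Classical in
/-- The array supported on vectors constant on the blocks of `g` and zero on its zero block. -/
noncomputable def blockArray {n m : ℕ} (g : Fin n → Option (Fin m)) (ℓ : Fin m → Bool)
    (x : Fin n → Bool) : ℂ :=
  if h : ∃ y, x = spread g y then Complex.I ^ pathExponent ℓ h.choose else 0

section blockArray

variable {n m : ℕ} {g : Fin n → Option (Fin m)}

theorem spread_injective (hg : ∀ k, ∃ j, g j = some k) : Function.Injective (spread g) := by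
  intro y y' h
  funext k
  obtain ⟨j, hj⟩ := hg k
  simpa [spread, hj] using congrFun h j

theorem blockArray_spread (hg : ∀ k, ∃ j, g j = some k) (ℓ y : Fin m → Bool) :
    blockArray g ℓ (spread g y) = Complex.I ^ pathExponent ℓ y := by
  have h : ∃ y', spread g y = spread g y' := ⟨y, rfl⟩
  rw [blockArray, dif_pos h, ← spread_injective hg h.choose_spec]

theorem blockArray_ne_zero_iff (ℓ : Fin m → Bool) (x : Fin n → Bool) :
    blockArray g ℓ x ≠ 0 ↔ ∃ y, x = spread g y := by
  rw [blockArray]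
  split_ifs with h
  · exact ⟨fun _ => h, fun _ => pow_ne_zero _ Complex.I_ne_zero⟩
  · simp [h]

theorem blockArray_eq_zero (ℓ : Fin m → Bool) {x : Fin n → Bool}
    (h : ¬ ∃ y, x = spread g y) : blockArray g ℓ x = 0 :=
  dif_neg h

theorem blockArray_comp (hg : ∀ k, ∃ j, g j = some k) (ℓ : Fin m → Bool)
    (σ : Equiv.Perm (Fin n)) (x : Fin n → Bool) :
    blockArray g ℓ (fun j => x (σ j)) = blockArray (fun j => g (σ.symm j)) ℓ x := by
  have hg' : ∀ k, ∃ j, g (σ.symm j) = some k := fun k => by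
    obtain ⟨j, hj⟩ := hg k
    exact ⟨σ j, by simpa using hj⟩
  by_cases h : ∃ y, x = spread (fun j => g (σ.symm j)) y
  · obtain ⟨y, rfl⟩ := h
    have : (fun j => spread (fun j => g (σ.symm j)) y (σ j)) = spread g y := by
      funext j
      simp [spread]
    rw [this, blockArray_spread hg, blockArray_spread hg']
  · have h' : ¬ ∃ y, (fun j => x (σ j)) = spread g y := by
      rintro ⟨y, hy⟩
      refine h ⟨y, funext fun j => ?_⟩
      simpa [spread] using congrFun hy (σ.symm j)
    rw [blockArray_eq_zero _ h, blockArray_eq_zero _ h']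

theorem pathExponent_rev (ℓ y : Fin m → Bool) :
    pathExponent (fun k => ℓ k.rev) (fun k => y k.rev) = pathExponent ℓ y := by
  unfold pathExponent
  congr 1
  · rw [Finset.sum_comm, ← Equiv.sum_comp Fin.revPerm]
    refine Finset.sum_congr rfl fun a _ => ?_
    rw [← Equiv.sum_comp Fin.revPerm]
    refine Finset.sum_congr rfl fun b _ => ?_
    have : b.rev.val + 1 = a.rev.val ↔ a.val + 1 = b.val := by
      simp only [Fin.val_rev]
      omega
    simp only [Fin.revPerm_apply, Fin.rev_rev, this, mul_comm]
  · exact Equiv.sum_comp Fin.revPerm fun a => if ℓ a then (y a).toNat else 0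

theorem blockArray_rev (hg : ∀ k, ∃ j, g j = some k) (ℓ : Fin m → Bool) :
    blockArray (fun j => (g j).map Fin.rev) (fun k => ℓ k.rev) = blockArray g ℓ := by
  have hg' : ∀ k, ∃ j, (g j).map Fin.rev = some k := fun k => by
    obtain ⟨j, hj⟩ := hg k.rev
    exact ⟨j, by simp [hj]⟩
  have key : ∀ y, spread (fun j => (g j).map Fin.rev) (fun k => y k.rev) = spread g y := by
    intro y
    funext j
    cases h : g j <;> simp [spread, h]
  funext x
  by_cases h : ∃ y, x = spread g y
  · obtain ⟨y, rfl⟩ := h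
    rw [blockArray_spread hg, ← key, blockArray_spread hg', pathExponent_rev]
  · have h' : ¬ ∃ y, x = spread (fun j => (g j).map Fin.rev) y := by
      rintro ⟨y, rfl⟩
      refine h ⟨fun k => y k.rev, ?_⟩
      rw [← key]
      simp
    rw [blockArray_eq_zero _ h, blockArray_eq_zero _ h']

theorem pathExponent_single (ℓ : Fin m → Bool) (k : Fin m) :
    pathExponent ℓ (fun a => decide (a = k)) = (ℓ k).toNat := by
  have h : ∀ a : Fin m, (decide (a = k)).toNat = if a = k then 1 else 0 := by
    intro a
    by_cases h : a = k <;> simp [h]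
  have h1 : ∀ a b : Fin m, (if a.val + 1 = b.val then
      2 * ((if a = k then 1 else 0) * (if b = k then 1 else 0)) else 0) = 0 := by
    intro a b
    split_ifs <;> first | rfl | (subst_vars; omega)
  have h2 : ∀ a, (if ℓ a then if a = k then 1 else 0 else 0) =
      if a = k then (ℓ k).toNat else 0 := by
    intro a
    by_cases h : a = k
    · subst h
      cases ℓ a <;> simp
    · simp [h]
  simp only [pathExponent, h, h1, h2]
  simp

theorem pathExponent_pair (ℓ : Fin m → Bool) {k l : Fin m} (hkl : k ≠ l) :
    pathExponent ℓ (fun a => decide (a = k ∨ a = l)) =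
      (if k.val + 1 = l.val ∨ l.val + 1 = k.val then 2 else 0) +
        ((ℓ k).toNat + (ℓ l).toNat) := by
  have h : ∀ a : Fin m, (decide (a = k ∨ a = l)).toNat =
      (if a = k then 1 else 0) + (if a = l then 1 else 0) := by
    intro a
    by_cases h : a = k
    · simp [h, hkl]
    · by_cases h' : a = l <;> simp [h, h', hkl.symm]
  have h1 : ∀ a b : Fin m, (if a.val + 1 = b.val then
      2 * (((if a = k then 1 else 0) + (if a = l then 1 else 0)) *
        ((if b = k then 1 else 0) + (if b = l then 1 else 0))) else 0) =
      (if a = k then (if b = l then (if k.val + 1 = l.val then 2 else 0) else 0) else 0) +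
      (if a = l then (if b = k then (if l.val + 1 = k.val then 2 else 0) else 0) else 0) := by
    intro a b
    split_ifs <;> first | rfl | (subst_vars; omega)
  have h2 : ∀ a, (if ℓ a then (if a = k then 1 else 0) + (if a = l then 1 else 0) else 0) =
      (if a = k then (ℓ k).toNat else 0) + (if a = l then (ℓ l).toNat else 0) := by
    intro a
    by_cases hk : a = k
    · subst hk
      cases ℓ a <;> simp [hkl]
    · by_cases hl : a = l
      · subst hl
        cases ℓ a <;> simp [hk]
      · simp [hk, hl]
  simp only [pathExponent, h, h1, h2, Finset.sum_add_distrib]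
  simp
  split_ifs <;> omega

theorem eq_none_iff_forall_spread {j : Fin n} : g j = none ↔ ∀ y, spread g y j = false := by
  constructor
  · intro h y
    simp [spread, h]
  · intro h
    cases hj : g j with
    | none => rfl
    | some k => simpa [spread, hj] using h fun _ => true

theorem eq_iff_forall_spread {j j' : Fin n} :
    g j = g j' ↔ ∀ y, spread g y j = spread g y j' := by
  constructor
  · intro h y
    simp [spread, h]
  · intro h
    cases hj : g j with
    | none =>
      have h := h fun _ => true
      cases hj' : g j' with
      | none => rfl
      | some k => simp [spread, hj, hj'] at h
    | some k =>
      have h := h fun a => decide (a = k)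
      cases hj' : g j' with
      | none => simp [spread, hj, hj'] at h
      | some l =>
        simp [spread, hj, hj'] at h
        rw [h]

theorem exists_equiv_of_blockArray_eq {m' : ℕ} {g' : Fin n → Option (Fin m')}
    (hg : ∀ k, ∃ j, g j = some k) (hg' : ∀ k, ∃ j, g' j = some k)
    {ℓ : Fin m → Bool} {ℓ' : Fin m' → Bool} (h : blockArray g ℓ = blockArray g' ℓ') :
    ∃ π : Fin m ≃ Fin m', (∀ j, g' j = (g j).map π) ∧
      ∀ y : Fin m' → Bool, Complex.I ^ pathExponent ℓ (fun k => y (π k)) =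
        Complex.I ^ pathExponent ℓ' y := by
  have hsupp : ∀ x, (∃ y, x = spread g y) ↔ ∃ y, x = spread g' y := by
    intro x
    rw [← blockArray_ne_zero_iff ℓ, ← blockArray_ne_zero_iff ℓ', h]
  have hnone : ∀ j, g j = none ↔ g' j = none := by
    intro j
    rw [eq_none_iff_forall_spread, eq_none_iff_forall_spread]
    constructor
    · intro hj y
      obtain ⟨y', hy'⟩ := (hsupp _).2 ⟨y, rfl⟩
      rw [hy', hj]
    · intro hj y
      obtain ⟨y', hy'⟩ := (hsupp _).1 ⟨y, rfl⟩
      rw [hy', hj]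
  have heq : ∀ j j', g j = g j' ↔ g' j = g' j' := by
    intro j j'
    rw [eq_iff_forall_spread, eq_iff_forall_spread]
    constructor
    · intro hj y
      obtain ⟨y', hy'⟩ := (hsupp _).2 ⟨y, rfl⟩
      rw [hy', hj]
    · intro hj y
      obtain ⟨y', hy'⟩ := (hsupp _).1 ⟨y, rfl⟩
      rw [hy', hj]
  have hπ : ∀ k, ∃ k', ∀ j, g j = some k ↔ g' j = some k' := by
    intro k
    obtain ⟨j, hj⟩ := hg k
    obtain ⟨k', hk'⟩ := Option.ne_none_iff_exists'.1
      (mt (hnone j).2 (by rw [hj]; exact Option.some_ne_none k))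
    exact ⟨k', fun j' => by rw [← hj, ← hk', heq]⟩
  choose π hπ using hπ
  have hbij : Function.Bijective π := by
    constructor
    · intro a b hab
      obtain ⟨j, hj⟩ := hg a
      have := (hπ b j).2 (hab ▸ (hπ a j).1 hj)
      exact Option.some_injective _ (hj.symm.trans this)
    · intro k'
      obtain ⟨j, hj⟩ := hg' k'
      obtain ⟨k, hk⟩ := Option.ne_none_iff_exists'.1
        (mt (hnone j).1 (by rw [hj]; exact Option.some_ne_none k'))
      exact ⟨k, Option.some_injective _ (((hπ k j).1 hk).symm.trans hj)⟩
  have hmap : ∀ j, g' j = (g j).map π := by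
    intro j
    cases hj : g j with
    | none => exact (hnone j).1 hj
    | some k => exact (hπ k j).1 hj
  refine ⟨Equiv.ofBijective π hbij, hmap, fun y => ?_⟩
  rw [← blockArray_spread hg, ← blockArray_spread hg', h]
  congr 1
  funext j
  simp only [spread, hmap]
  cases g j <;> simp

theorem I_pow_toNat_injective {a b : Bool} (h : Complex.I ^ a.toNat = Complex.I ^ b.toNat) :
    a = b := by
  cases a <;> cases b <;> simp [Complex.ext_iff] at h ⊢

theorem blockArray_eq_imp {g' : Fin n → Option (Fin m)}
    (hg : ∀ k, ∃ j, g j = some k) (hg' : ∀ k, ∃ j, g' j = some k)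
    {ℓ ℓ' : Fin m → Bool} (h : blockArray g ℓ = blockArray g' ℓ') :
    (g' = g ∧ ℓ' = ℓ) ∨
      (g' = (fun j => (g j).map Fin.rev) ∧ ℓ' = fun k => ℓ k.rev) := by
  obtain ⟨π, hmap, hI⟩ := exists_equiv_of_blockArray_eq hg hg' h
  have hℓ : ∀ k, ℓ k = ℓ' (π k) := by
    intro k
    have := hI fun a => decide (a = π k)
    simp only [π.injective.eq_iff, pathExponent_single] at this
    exact I_pow_toNat_injective this
  have hadj : ∀ a b : Fin m, (a.val + 1 = b.val ∨ b.val + 1 = a.val) ↔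
      ((π a).val + 1 = (π b).val ∨ (π b).val + 1 = (π a).val) := by
    intro a b
    rcases eq_or_ne a b with rfl | hab
    · simp
    have := hI fun c => decide (c = π a ∨ c = π b)
    simp only [π.injective.eq_iff, pathExponent_pair _ hab,
      pathExponent_pair _ (π.injective.ne hab), pow_add, hℓ] at this
    have := mul_right_cancel₀ (mul_ne_zero (pow_ne_zero _ Complex.I_ne_zero)
      (pow_ne_zero _ Complex.I_ne_zero)) this
    split_ifs at this with h1 h2 h2
    · simp [h1, h2]
    · norm_num at this
    · norm_num at this
    · simp [h1, h2]
  rcases eq_id_or_eq_rev_of_adj π hadj with hπ | hπ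
  · left
    have : (π : Fin m → Fin m) = id := funext hπ
    refine ⟨funext fun j => ?_, funext fun k => ?_⟩
    · rw [hmap, this, Option.map_id, id]
    · rw [hℓ, hπ]
  · right
    have : (π : Fin m → Fin m) = Fin.rev := funext hπ
    refine ⟨funext fun j => ?_, funext fun k => ?_⟩
    · rw [hmap, this]
    · rw [hℓ, hπ, Fin.rev_rev]

end blockArray

/-! ### The number of block arrays -/

/-- Labelled paths of blocks in `Fin n`. -/
abbrev LabelledPath (n : ℕ) : Type :=
  Σ m : Fin (n + 1), BlockMap n m × (Fin m → Bool)

namespace LabelledPath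

variable {n : ℕ}

/-- The array of a labelled path. -/
noncomputable def array (d : LabelledPath n) : (Fin n → Bool) → ℂ :=
  blockArray d.2.1.1 d.2.2

/-- The labelled path traversed backwards. -/
def reverse (d : LabelledPath n) : LabelledPath n :=
  ⟨d.1, ⟨fun j => (d.2.1.1 j).map Fin.rev, fun k => by
    obtain ⟨j, hj⟩ := d.2.1.2 k.rev
    exact ⟨j, by simp [hj]⟩⟩, fun k => d.2.2 k.rev⟩

theorem array_eq_iff (d d' : LabelledPath n) :
    d.array = d'.array ↔ d' = d ∨ d' = d.reverse := by
  constructor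
  · intro h
    obtain ⟨m, ⟨g, hg⟩, ℓ⟩ := d
    obtain ⟨m', ⟨g', hg'⟩, ℓ'⟩ := d'
    obtain ⟨π, -⟩ := exists_equiv_of_blockArray_eq hg hg' h
    obtain rfl : m = m' := Fin.ext (by simpa using Fintype.card_congr π)
    rcases blockArray_eq_imp hg hg' h with ⟨rfl, rfl⟩ | ⟨rfl, rfl⟩
    · exact Or.inl rfl
    · exact Or.inr rfl
  · rintro (rfl | rfl)
    · rfl
    · exact (blockArray_rev d.2.1.2 d.2.2).symm

theorem reverse_eq_iff (d : LabelledPath n) : d.reverse = d ↔ d.1.val ≤ 1 := by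
  obtain ⟨m, ⟨g, hg⟩, ℓ⟩ := d
  constructor
  · intro h
    have h' : (fun j => (g j).map Fin.rev) = g := by
      simpa [reverse] using congrArg Prod.fst (eq_of_heq (Sigma.mk.inj h).2)
    by_contra! hm
    obtain ⟨j, hj⟩ := hg ⟨0, by simp only at hm; omega⟩
    have := congrFun h' j
    simp only [hj, Option.map_some, Option.some.injEq, Fin.ext_iff, Fin.val_rev] at this
    simp only at hm
    omega
  · intro h
    simp only at h
    have hrev : ∀ k : Fin m, k.rev = k := fun k => Fin.ext (by rw [Fin.val_rev]; omega)
    have hrev' : (Fin.rev : Fin m → Fin m) = id := funext hrev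
    simp [reverse, hrev, hrev']

theorem card_filter_reverse_eq (hn : 1 ≤ n) :
    (Finset.univ.filter fun d : LabelledPath n => d.reverse = d).card + 1 = 2 ^ (n + 1) := by
  have h : (Finset.univ.filter fun d : LabelledPath n => d.reverse = d) =
      (Finset.univ.filter fun m : Fin (n + 1) => m.val ≤ 1).sigma fun _ => Finset.univ := by
    ext d
    simp [reverse_eq_iff]
  have h2 : (Finset.univ.filter fun m : Fin (n + 1) => m.val ≤ 1) =
      {⟨0, by omega⟩, ⟨1, by omega⟩} := by
    ext m
    simp only [Finset.mem_filter, Finset.mem_univ, true_and, Finset.mem_insert,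
      Finset.mem_singleton, Fin.ext_iff]
    omega
  rw [h, Finset.card_sigma, h2, Finset.sum_pair (by simp)]
  simp only [Finset.card_univ, Fintype.card_prod, Fintype.card_fun, Fintype.card_bool,
    Fintype.card_fin]
  have h1 := card_blockMap_one hn
  rw [card_blockMap_zero hn, pow_succ 2 n, ← h1]
  ring

theorem card_eq (n : ℕ) :
    2 * Fintype.card (LabelledPath n) + stirling2 n 0 =
      3 * ∑ k ∈ Finset.range (n + 1), 2 ^ k * k.factorial * stirling2 n k := by
  have h : Fintype.card (LabelledPath n) = ∑ k ∈ Finset.range (n + 1),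
      2 ^ k * (k.factorial * stirling2 n k + (k + 1).factorial * stirling2 n (k + 1)) := by
    rw [Fintype.card_sigma, ← Fin.sum_univ_eq_sum_range (fun k => 2 ^ k *
      (k.factorial * stirling2 n k + (k + 1).factorial * stirling2 n (k + 1)))]
    refine Finset.sum_congr rfl fun m _ => ?_
    rw [Fintype.card_prod, card_blockMap]
    simp [mul_comm]
  have h2 := Finset.sum_range_succ' (fun k => 2 ^ k * k.factorial * stirling2 n k) (n + 1)
  rw [Finset.sum_range_succ, stirling2_eq_zero_of_lt (Nat.lt_succ_self n)] at h2
  have h3 : ∑ k ∈ Finset.range (n + 1),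
      2 ^ (k + 1) * (k + 1).factorial * stirling2 n (k + 1) =
      2 * ∑ k ∈ Finset.range (n + 1), 2 ^ k * ((k + 1).factorial * stirling2 n (k + 1)) := by
    rw [Finset.mul_sum]
    exact Finset.sum_congr rfl fun k _ => by ring
  simp only [h, mul_add, Finset.sum_add_distrib, ← mul_assoc] at h2 h3 ⊢
  simp at h2
  omega

theorem four_mul_ncard_range_array (hn : 1 ≤ n) :
    4 * (Set.range (array (n := n))).ncard + 2 =
      3 * (∑ k ∈ Finset.range (n + 1), 2 ^ k * k.factorial * stirling2 n k) +
        2 ^ (n + 2) := by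
  classical
  have h1 := two_mul_ncard_range (array (n := n)) reverse array_eq_iff
  have h2 := card_filter_reverse_eq hn
  have h3 := card_eq n
  have h4 : stirling2 n 0 = 0 := by
    obtain ⟨n, rfl⟩ := Nat.exists_eq_succ_of_ne_zero (Nat.one_le_iff_ne_zero.1 hn)
    rfl
  have h5 : 2 ^ (n + 2) = 2 * 2 ^ (n + 1) := by ring
  have h6 : (Finset.univ.filter fun d : LabelledPath n => d.reverse = d).card + 1 =
    2 ^ (n + 1) := by convert h2
  omega

end LabelledPath

/-! ### The arrays `fIHN` as block arrays -/

section fIHN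

variable {n : ℕ}

theorem mem_PsetIHN {c : Fin n → Fin 3} {j : Fin n} : j.val ∈ PsetIHN n c ↔ c j ≠ 0 := by
  simp [PsetIHN, Fin.val_inj]

theorem lt_of_mem_PsetIHN {c : Fin n → Fin 3} {j : ℕ} (h : j ∈ PsetIHN n c) : j < n := by
  obtain ⟨i, -, rfl⟩ := Finset.mem_image.1 h
  exact i.isLt

theorem nxt_eq_or_mem (P : Finset ℕ) (j : ℕ) : nxt n P j = n ∨ nxt n P j ∈ P := by
  rw [nxt]
  split_ifs with h
  · exact Or.inr (Finset.mem_filter.1 (Finset.min'_mem _ h)).1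
  · exact Or.inl rfl

theorem count_nxt {P : Finset ℕ} (hP : ∀ p ∈ P, p < n) (j : ℕ) :
    Nat.count (· ∈ P) (nxt n P j) = Nat.count (· ∈ P) (j + 1) := by
  rw [Nat.count_eq_card_filter_range, Nat.count_eq_card_filter_range]
  congr 1
  ext p
  simp only [Finset.mem_filter, Finset.mem_range, and_congr_left_iff]
  intro hp
  rw [nxt]
  split_ifs with h
  · have h1 := (Finset.mem_filter.1 (Finset.min'_mem _ h)).2
    constructor
    · intro hlt
      by_contra hc
      have := Finset.min'_le (P.filter (j < ·)) p (Finset.mem_filter.2 ⟨hp, by omega⟩)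
      exact absurd hlt this.not_gt
    · omega
  · refine ⟨fun _ => ?_, fun _ => hP p hp⟩
    by_contra hc
    exact h ⟨p, Finset.mem_filter.2 ⟨hp, by omega⟩⟩

/-- The index of a block, where the zero block comes last. -/
def blockIndex {m : ℕ} (o : Option (Fin m)) : ℕ :=
  o.elim m Fin.val

theorem blockIndex_injective {m : ℕ} : Function.Injective (blockIndex (m := m)) := by
  intro a b h
  rcases a with _ | a <;> rcases b with _ | b
  · rfl
  · exact absurd h.symm b.isLt.ne
  · exact absurd h a.isLt.ne
  · exact congrArg some (Fin.ext h)

theorem blockIndex_le {m : ℕ} (o : Option (Fin m)) : blockIndex o ≤ m := by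
  cases o with
  | none => exact le_rfl
  | some k => exact k.isLt.le

variable {c : Fin n → Fin 3} {m : ℕ} {g : Fin n → Option (Fin m)}

theorem exists_block_eq (hm : Nat.count (· ∈ PsetIHN n c) n = m)
    (hg : ∀ j, blockIndex (g j) = Nat.count (· ∈ PsetIHN n c) j.val) (k : Fin m) :
    ∃ j, c j ≠ 0 ∧ g j = some k := by
  have hk : k.val < Nat.count (· ∈ PsetIHN n c) n := hm ▸ k.isLt
  have hlt := Nat.nth_lt_of_lt_count hk
  refine ⟨⟨_, hlt⟩, mem_PsetIHN.1 ?_, blockIndex_injective ?_⟩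
  · exact Nat.nth_mem_of_lt_card (p := (· ∈ PsetIHN n c)) (PsetIHN n c).finite_toSet
      (hk.trans_le (Nat.count_le_card _ n))
  · rw [hg]
    exact Nat.count_nth_of_lt_card_finite (p := (· ∈ PsetIHN n c)) (PsetIHN n c).finite_toSet
      (hk.trans_le (Nat.count_le_card _ n))

theorem exists_eq_some (hm : Nat.count (· ∈ PsetIHN n c) n = m)
    (hg : ∀ j, blockIndex (g j) = Nat.count (· ∈ PsetIHN n c) j.val) {j : Fin n}
    (hj : c j ≠ 0) : ∃ k, g j = some k := by
  refine Option.ne_none_iff_exists'.1 fun h => ?_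
  have h1 := hg j
  rw [h, blockIndex, Option.elim_none, ← hm] at h1
  have h2 := Nat.count_strict_mono (p := (· ∈ PsetIHN n c)) (mem_PsetIHN.2 hj) j.isLt
  omega

theorem eq_of_block_eq (hg : ∀ j, blockIndex (g j) = Nat.count (· ∈ PsetIHN n c) j.val)
    {j j' : Fin n} (hj : c j ≠ 0) (hj' : c j' ≠ 0) (h : g j = g j') : j = j' := by
  refine Fin.ext (Nat.count_injective (mem_PsetIHN.2 hj) (mem_PsetIHN.2 hj') ?_)
  rw [← hg, ← hg, h]

theorem sum_filter_eq_sum_blocks (hm : Nat.count (· ∈ PsetIHN n c) n = m)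
    (hg : ∀ j, blockIndex (g j) = Nat.count (· ∈ PsetIHN n c) j.val)
    {φ : Fin n → ℕ} {ψ : Fin m → ℕ} (h : ∀ j k, c j ≠ 0 → g j = some k → φ j = ψ k) :
    ∑ j ∈ Finset.univ.filter (fun j => c j ≠ 0), φ j = ∑ k, ψ k := by
  choose s hs hgs using exists_block_eq hm hg
  symm
  refine Finset.sum_bij (fun k _ => s k) ?_ ?_ ?_ ?_
  · simpa using hs
  · intro a _ b _ hab
    simpa [hgs] using congrArg g hab
  · intro j hj
    have hj' : c j ≠ 0 := by simpa using hj
    obtain ⟨k, hk⟩ := exists_eq_some hm hg hj'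
    exact ⟨k, Finset.mem_univ k, eq_of_block_eq hg (hs k) hj' ((hgs k).trans hk.symm)⟩
  · intro k _
    exact (h _ _ (hs k) (hgs k)).symm

theorem fIHN_eq_blockArray (hm : Nat.count (· ∈ PsetIHN n c) n = m)
    (hg : ∀ j, blockIndex (g j) = Nat.count (· ∈ PsetIHN n c) j.val)
    {ℓ : Fin m → Bool} (hℓ : ∀ j k, c j ≠ 0 → g j = some k → (c j = 2 ↔ ℓ k = true)) :
    fIHN n c = blockArray g ℓ := by
  have hsurj : ∀ k, ∃ j, g j = some k := fun k =>
    (exists_block_eq hm hg k).imp fun _ h => h.2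
  have hcount : ∀ j : Fin n, Nat.count (· ∈ PsetIHN n c) (nxt n (PsetIHN n c) j) =
      Nat.count (· ∈ PsetIHN n c) j + if c j ≠ 0 then 1 else 0 := by
    intro j
    rw [count_nxt (fun p hp => lt_of_mem_PsetIHN hp), Nat.count_succ]
    simp only [mem_PsetIHN]
  funext x
  by_cases hx : ∃ y, x = spread g y
  · obtain ⟨y, rfl⟩ := hx
    rw [blockArray_spread hsurj]
    set Y : ℕ → ℕ := fun k => if h : k < m then (y ⟨k, h⟩).toNat else 0 with hY
    have hYx : ∀ j : Fin n, (spread g y j).toNat =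
        Y (Nat.count (· ∈ PsetIHN n c) j.val) := by
      intro j
      rw [← hg, spread]
      cases g j <;> simp [hY, blockIndex]
    have hYe : ∀ j, j = n ∨ j ∈ PsetIHN n c →
        extBit n (spread g y) j = Y (Nat.count (· ∈ PsetIHN n c) j) := by
      rintro j (rfl | hj)
      · simp [extBit, hY, hm]
      · rw [extBit, dif_pos (lt_of_mem_PsetIHN hj)]
        exact hYx ⟨j, lt_of_mem_PsetIHN hj⟩
    rw [fIHN, Finset.prod_eq_one, one_mul]
    · congr 1
      rw [pathExponent, Finset.mul_sum, PsetIHN, Finset.sum_image fun _ _ _ _ h => Fin.ext h,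
        ← PsetIHN]
      congr 1
      · refine sum_filter_eq_sum_blocks hm hg fun j k hj hk => ?_
        have hck : Nat.count (· ∈ PsetIHN n c) j.val = k.val := by rw [← hg, hk]; rfl
        rw [hYe _ (Or.inr (mem_PsetIHN.2 hj)), hYe _ (nxt_eq_or_mem _ _), hcount, if_pos hj, hck]
        have hYk : Y k.val = (y k).toNat := by simp [hY]
        rw [hYk]
        by_cases hlt : k.val + 1 < m
        · rw [Finset.sum_eq_single ⟨k.val + 1, hlt⟩]
          · simp [hY, hlt]
          · intro b _ hb
            exact if_neg fun h => hb (Fin.ext h.symm)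
          · simp
        · rw [Finset.sum_eq_zero]
          · simp [hY, hlt]
          · intro b _
            exact if_neg fun h => hlt (by omega)
      · rw [← sum_filter_eq_sum_blocks hm hg
          (φ := fun j => if c j = 2 then (spread g y j).toNat else 0), ← Finset.sum_filter,
          Finset.filter_filter]
        · congr 1
          ext j
          simp only [Finset.mem_filter, Finset.mem_univ, true_and]
          exact ⟨fun h => ⟨by rw [h]; decide, h⟩, fun h => h.2⟩
        · intro j k hj hk
          simp only [hℓ j k hj hk, spread, hk, Option.elim_some]
    · intro j hj
      have hj' : c j = 0 := by simpa using hj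
      rw [if_pos]
      rw [hYe _ (nxt_eq_or_mem _ _), hcount, hYx]
      simp [hj']
  · rw [blockArray_eq_zero _ hx, fIHN, mul_eq_zero]
    left
    by_contra hne
    rw [← ne_eq, Finset.prod_ne_zero_iff] at hne
    have hne' : ∀ j, c j = 0 →
        (x j).toNat = extBit n x (nxt n (PsetIHN n c) j.val) := by
      intro j hj
      by_contra h
      exact hne j (by simpa using hj) (if_neg h)
    choose s hs hgs using exists_block_eq hm hg
    have hfix : ∀ j k, c j ≠ 0 → g j = some k → s k = j := fun j k hj hk =>
      eq_of_block_eq hg (hs k) hj ((hgs k).trans hk.symm)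
    refine hx ⟨fun k => x (s k), funext fun j => ?_⟩
    by_cases hj : c j = 0
    · have h1 := hne' j hj
      have h2 := hcount j
      rw [if_neg (not_not.2 hj), add_zero, ← hg] at h2
      rcases nxt_eq_or_mem (n := n) (PsetIHN n c) j with h | h
      · have : g j = none := blockIndex_injective (by rw [← h2, h, hm]; rfl)
        rw [h] at h1
        simpa [extBit, spread, this] using h1
      · have hlt := lt_of_mem_PsetIHN h
        have hc : c ⟨_, hlt⟩ ≠ 0 := mem_PsetIHN.1 h
        obtain ⟨k, hk⟩ := exists_eq_some hm hg hc
        have hgj : g j = some k := by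
          rw [← hk]
          exact blockIndex_injective (by rw [← h2, hg])
        rw [extBit, dif_pos hlt] at h1
        simp only [spread, hgj, Option.elim_some, hfix _ _ hc hk]
        revert h1
        cases x j <;> cases x ⟨_, hlt⟩ <;> simp
    · obtain ⟨k, hk⟩ := exists_eq_some hm hg hj
      simp [spread, hk, hfix j k hj hk]

theorem exists_fIHN_eq_array (c : Fin n → Fin 3) :
    ∃ d : LabelledPath n, fIHN n c = d.array := by
  set m := Nat.count (· ∈ PsetIHN n c) n with hm
  let g : Fin n → Option (Fin m) := fun j =>
    if h : Nat.count (· ∈ PsetIHN n c) j.val < m then some ⟨_, h⟩ else none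
  have hg : ∀ j, blockIndex (g j) = Nat.count (· ∈ PsetIHN n c) j.val := by
    intro j
    by_cases h : Nat.count (· ∈ PsetIHN n c) j.val < m
    · simp [g, h, blockIndex]
    · have := Nat.count_monotone (· ∈ PsetIHN n c) j.isLt.le
      simp only [g, h, dif_neg, not_false_eq_true, blockIndex, Option.elim_none]
      omega
  choose s hs hgs using exists_block_eq hm.symm hg
  refine ⟨⟨⟨m, Nat.lt_succ_of_le (Nat.count_le _)⟩, ⟨g, fun k => ⟨s k, hgs k⟩⟩,
    fun k => decide (c (s k) = 2)⟩, fIHN_eq_blockArray hm.symm hg fun j k hj hk => ?_⟩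
  rw [eq_of_block_eq hg hj (hs k) (hk.trans (hgs k).symm)]
  simp

theorem exists_fIHN_eq_blockArray (hg : ∀ k, ∃ j, g j = some k)
    (hmono : Monotone fun j => blockIndex (g j)) (ℓ : Fin m → Bool) :
    ∃ c, fIHN n c = blockArray g ℓ := by
  let K : ℕ → ℕ := fun j => if h : j < n then blockIndex (g ⟨j, h⟩) else m
  have hK : ∀ j : Fin n, K j = blockIndex (g j) := fun j => dif_pos j.isLt
  have hKm : ∀ j, K j ≤ m := by
    intro j
    simp only [K]
    split_ifs
    · exact blockIndex_le _
    · exact le_rfl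
  have hKmono : Monotone K := by
    intro i j hij
    by_cases hj : j < n
    · have := hmono (show (⟨i, by omega⟩ : Fin n) ≤ ⟨j, hj⟩ from hij)
      simpa [K, hj, hij.trans_lt hj] using this
    · simpa [K, hj] using hKm i
  have hKsurj : ∀ k < m, ∃ j, K j = k := by
    intro k hk
    obtain ⟨j, hj⟩ := hg ⟨k, hk⟩
    exact ⟨j, by rw [hK, hj]; rfl⟩
  let c : Fin n → Fin 3 := fun j =>
    if K (j + 1) = K j then 0 else if (g j).elim false ℓ then 2 else 1
  have hc : ∀ j, c j ≠ 0 ↔ K (j + 1) ≠ K j := by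
    intro j
    simp only [c]
    split_ifs <;> simp_all
  have hcount : ∀ j ≤ n, Nat.count (· ∈ PsetIHN n c) j = K j := by
    intro j
    induction j with
    | zero =>
      intro _
      rw [Nat.count_zero]
      rcases Nat.eq_zero_or_pos m with h | h
      · have := hKm 0
        omega
      · obtain ⟨j, hj⟩ := hKsurj 0 h
        have := hKmono (Nat.zero_le j)
        omega
    | succ j ih =>
      intro hj
      rw [Nat.count_succ, ih (by omega)]
      have h1 : j ∈ PsetIHN n c ↔ K (j + 1) ≠ K j := by
        rw [← hc ⟨j, hj⟩, ← mem_PsetIHN]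
      have h2 := hKmono (Nat.le_succ j)
      have h3 : K (j + 1) ≤ K j + 1 := by
        by_contra! h
        obtain ⟨i, hi⟩ := hKsurj (K j + 1) (h.trans_le (hKm _))
        rcases Nat.lt_or_ge j i with hij | hij
        · have := hKmono (Nat.succ_le_of_lt hij)
          simp only [Nat.succ_eq_add_one] at this
          omega
        · have := hKmono hij
          omega
      simp only [Nat.succ_eq_add_one] at h2
      split_ifs with h
      · have := h1.1 h
        omega
      · have := not_not.1 (mt h1.2 h)
        omega
  refine ⟨c, fIHN_eq_blockArray ?_ (fun j => ?_) fun j k hj hk => ?_⟩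
  · rw [hcount n le_rfl]
    exact dif_neg (lt_irrefl n)
  · rw [hcount j j.isLt.le, hK]
  · have := (hc j).1 hj
    simp only [c, this, if_false, hk, Option.elim_some]
    cases ℓ k <;> simp

theorem setOf_fIHN_comp_eq_range (n : ℕ) :
    {f : (Fin n → Bool) → ℂ | ∃ (c : Fin n → Fin 3) (σ : Equiv.Perm (Fin n)),
      f = fun x => fIHN n c (fun j => x (σ j))} = Set.range (LabelledPath.array (n := n)) := by
  ext f
  constructor
  · rintro ⟨c, σ, rfl⟩
    obtain ⟨⟨m, ⟨g, hg⟩, ℓ⟩, hd⟩ := exists_fIHN_eq_array c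
    refine ⟨⟨m, ⟨fun j => g (σ.symm j), fun k => ?_⟩, ℓ⟩, ?_⟩
    · obtain ⟨j, hj⟩ := hg k
      exact ⟨σ j, by simpa using hj⟩
    · funext x
      rw [hd]
      exact (blockArray_comp hg ℓ σ x).symm
  · rintro ⟨⟨m, ⟨g, hg⟩, ℓ⟩, rfl⟩
    let σ := Tuple.sort fun j => blockIndex (g j)
    have hg' : ∀ k, ∃ j, g (σ j) = some k := fun k => by
      obtain ⟨j, hj⟩ := hg k
      exact ⟨σ.symm j, by simpa using hj⟩
    obtain ⟨c, hc⟩ := exists_fIHN_eq_blockArray hg'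
      (Tuple.monotone_sort fun j => blockIndex (g j)) ℓ
    refine ⟨c, σ, funext fun x => ?_⟩
    rw [hc, blockArray_comp hg']
    simp [LabelledPath.array]

end fIHN

/-- Theorem 3 of the paper: the number of distinct sequences obtained from the
arrays `f_c`, `c ∈ {I,H,N}^n`, by all coordinate permutations, is
`E_IHN(n) = 3 ∑_{k=0}^n 2^{k-2} k! S(n,k) + 2^n - 1/2`, an identity of
rational numbers. -/
theorem stmt5 (n : ℕ) (hn : 1 ≤ n) :
    (({f : (Fin n → Bool) → ℂ | ∃ (c : Fin n → Fin 3) (σ : Equiv.Perm (Fin n)),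
        f = fun x => fIHN n c (fun j => x (σ j))}).ncard : ℚ) =
      3 * ∑ k ∈ Finset.range (n + 1),
          (2 : ℚ) ^ ((k : ℤ) - 2) * Nat.factorial k * stirling2 n k
        + 2 ^ n - 1 / 2 := by
  have h := LabelledPath.four_mul_ncard_range_array hn
  have hsum : ∑ k ∈ Finset.range (n + 1),
      (2 : ℚ) ^ ((k : ℤ) - 2) * Nat.factorial k * stirling2 n k =
      (∑ k ∈ Finset.range (n + 1), 2 ^ k * k.factorial * stirling2 n k : ℕ) / 4 := by
    push_cast
    rw [Finset.sum_div]
    refine Finset.sum_congr rfl fun k _ => ?_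
    rw [zpow_sub₀ two_ne_zero, zpow_natCast]
    norm_num
    ring
  rw [setOf_fIHN_comp_eq_range, hsum]
  have h' := congrArg (Nat.cast : ℕ → ℚ) h
  rw [Nat.cast_add, Nat.cast_add, Nat.cast_mul, Nat.cast_mul, Nat.cast_pow, pow_add] at h'
  simp only [Nat.cast_ofNat] at h'
  linarith
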